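/- arXiv:1810.04004 — 2 statements merged into one kernel-verified Lean document; each statement's English description precedes it below -/
import Mathlib

section
/- Let n, m be integers with 7 ≤ n ≤ m, m ≤ 3 + binom(n-3,2), and also n - 3 < binom(m-3,2) (the 'otherwise' case). Let x* be the (unique) real number in [3, n-3] satisfying m - x*(x*-1)/2 = (1 + √(1 + 8(n - x*)))/2. Then sg(K_{n,m}) = min{ G(⌈x*⌉ - 1), F(⌈x*⌉) }. -/
open SimpleGraph

/-- A set `S` of vertices is a strong geodetic set of `G` if one can fix, for each
pair of vertices of `S`, a single geodesic (shortest path) between them, so that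
every vertex of the graph lies on one of the chosen geodesics. -/
def IsStrongGeodeticSet {V : Type*} (G : SimpleGraph V) (S : Set V) : Prop :=
  ∃ γ : ∀ u ∈ S, ∀ v ∈ S, G.Walk u v,
    (∀ u (hu : u ∈ S) v (hv : v ∈ S), (γ u hu v hv).length = G.dist u v) ∧
    (∀ u (hu : u ∈ S) v (hv : v ∈ S), γ u hu v hv = (γ v hv u hu).reverse) ∧
    (∀ x : V, ∃ u, ∃ hu : u ∈ S, ∃ v, ∃ hv : v ∈ S, x ∈ (γ u hu v hv).support)

/-- The strong geodetic number of a finite graph: the minimum cardinality of a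
strong geodetic set. -/
noncomputable def strongGeodeticNumber {V : Type*} [Fintype V] (G : SimpleGraph V) : ℕ :=
  sInf {k | ∃ S : Finset V, S.card = k ∧ IsStrongGeodeticSet G ↑S}

/-- `fFun n p = min {q : binom(q,2) ≥ n - p}`. -/
noncomputable def fFun (n : ℕ) (p : ℕ) : ℕ := sInf {q : ℕ | n - p ≤ q.choose 2}

/-- `gFun m p = m - binom(p,2)` (as an integer). -/
def gFun (m : ℕ) (p : ℕ) : ℤ := (m : ℤ) - (p.choose 2 : ℤ)

/-- The continuous extension `f̃(x) = (1 + √(1 + 8(n - x)))/2`. -/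
noncomputable def ftilde (n : ℕ) (x : ℝ) : ℝ := (1 + Real.sqrt (1 + 8 * ((n : ℝ) - x))) / 2

/-- The continuous extension `g̃(x) = m - x(x-1)/2`. -/
noncomputable def gtilde (m : ℕ) (x : ℝ) : ℝ := (m : ℝ) - x * (x - 1) / 2

/-- A set of vertices outside `S`, all of whose neighbours in `S` lie in `B`, has at most
`binom(|B|, 2)` elements when `S` is strong geodetic in a graph of diameter at most two. -/
theorem IsStrongGeodeticSet.card_le_choose_two {V : Type*} [DecidableEq V] {G : SimpleGraph V}
    {S : Set V} (hS : IsStrongGeodeticSet G S) (hdist : ∀ u v, G.dist u v ≤ 2)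
    (T B : Finset V) (hT : ∀ x ∈ T, x ∉ S) (hB : ∀ x ∈ T, ∀ u ∈ S, G.Adj u x → u ∈ B) :
    T.card ≤ B.card.choose 2 := by
  obtain ⟨γ, hlen, hsymm, hcov⟩ := hS
  have key : ∀ x ∈ T, ∃ u, ∃ hu : u ∈ S, ∃ v, ∃ hv : v ∈ S,
      u ∈ B ∧ v ∈ B ∧ u ≠ v ∧ (γ u hu v hv).length = 2 ∧ (γ u hu v hv).getVert 1 = x := by
    intro x hx
    obtain ⟨u, hu, v, hv, hmem⟩ := hcov x
    have hux : u ≠ x := fun h => hT x hx (h ▸ hu)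
    have hvx : v ≠ x := fun h => hT x hx (h ▸ hv)
    have hl := hlen u hu v hv
    have hl2 : (γ u hu v hv).length ≤ 2 := hl ▸ hdist u v
    refine ⟨u, hu, v, hv, ?_⟩
    have huv : u ≠ v := by
      rintro rfl
      rw [dist_self] at hl
      rw [Walk.length_eq_zero_iff, ← Walk.eq_nil_iff_nil] at hl
      simp only [hl, Walk.support_nil, List.mem_singleton] at hmem
      exact hux hmem.symm
    generalize γ u hu v hv = w at hmem hl2
    match w, hmem, hl2 with
    | .nil, hmem, _ => exact absurd rfl huv
    | .cons h .nil, hmem, _ =>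
      simp at hmem
      rcases hmem with h | h
      · exact absurd h.symm hux
      · exact absurd h.symm hvx
    | .cons h (.cons h' .nil), hmem, _ =>
      simp at hmem
      rcases hmem with h1 | h1 | h1
      · exact absurd h1.symm hux
      · subst h1
        exact ⟨hB _ hx _ hu h, hB _ hx _ hv h'.symm, huv, by simp, by simp⟩
      · exact absurd h1.symm hvx
    | .cons _ (.cons _ (.cons _ _)), _, hl2 =>
      simp at hl2
  choose! a ha b hb haB hbB hab hl hget using key
  rw [← Sym2.card_image_offDiag]
  refine Finset.card_le_card_of_injOn (fun x => s(a x, b x)) ?_ ?_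
  · intro x hx
    simp only [Finset.coe_image, Set.mem_image, Finset.mem_coe, Finset.mem_offDiag]
    exact ⟨(a x, b x), ⟨haB x hx, hbB x hx, hab x hx⟩, rfl⟩
  · intro x hx y hy hxy
    have hx' := hget x hx
    have hy' := hget y hy
    have hlx := hl x hx
    generalize_proofs p1 p2 p3 p4 at hx' hy' hlx
    dsimp only at hxy
    generalize a x = u at *
    generalize b x = v at *
    generalize a y = u' at *
    generalize b y = v' at *
    rcases Sym2.eq_iff.1 hxy with ⟨rfl, rfl⟩ | ⟨rfl, rfl⟩
    · exact hx'.symm.trans hy'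
    · rw [hsymm, Walk.length_reverse] at hlx
      rw [hsymm, Walk.getVert_reverse, hlx] at hx'
      exact hx'.symm.trans hy'

section CompleteBipartite

variable {V W : Type*} [DecidableEq V] [DecidableEq W]

/-- The geodesics of a complete bipartite graph with prescribed midpoints `φ`, `ψ`. -/
def bipartiteGeodesic (φ : Sym2 V → W) (ψ : Sym2 W → V) :
    ∀ u v : V ⊕ W, (completeBipartiteGraph V W).Walk u v
  | .inl a, .inr b => Walk.cons (by simp) .nil
  | .inr a, .inl b => Walk.cons (by simp) .nil
  | .inl a, .inl b =>
    if h : a = b then Walk.nil.copy rfl (congrArg Sum.inl h)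
    else Walk.cons (v := .inr (φ s(a, b))) (by simp) (Walk.cons (by simp) .nil)
  | .inr a, .inr b =>
    if h : a = b then Walk.nil.copy rfl (congrArg Sum.inr h)
    else Walk.cons (v := .inl (ψ s(a, b))) (by simp) (Walk.cons (by simp) .nil)

theorem length_bipartiteGeodesic_le (φ : Sym2 V → W) (ψ : Sym2 W → V) (u v : V ⊕ W) :
    (bipartiteGeodesic φ ψ u v).length ≤ 2 := by
  rcases u with a | a <;> rcases v with b | b <;> simp only [bipartiteGeodesic] <;>
    try split_ifs
  all_goals simp

theorem two_le_length_of_not_adj {U : Type*} {G : SimpleGraph U} {u v : U} (huv : u ≠ v)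
    (h : ¬ G.Adj u v) : ∀ w : G.Walk u v, 2 ≤ w.length
  | .nil => absurd rfl huv
  | .cons h' .nil => absurd h' h
  | .cons _ (.cons _ _) => by simp

theorem length_bipartiteGeodesic (φ : Sym2 V → W) (ψ : Sym2 W → V) (u v : V ⊕ W) :
    (bipartiteGeodesic φ ψ u v).length = (completeBipartiteGraph V W).dist u v := by
  refine le_antisymm ?_ (dist_le _)
  obtain ⟨w, hw⟩ := (bipartiteGeodesic φ ψ u v).reachable.exists_walk_length_eq_dist
  rw [← hw]
  by_cases huv : u = v
  · subst huv
    rcases u with a | a <;> simp [bipartiteGeodesic]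
  by_cases hadj : (completeBipartiteGraph V W).Adj u v
  · have h0 : w.length ≠ 0 := fun h => huv (Walk.eq_of_length_eq_zero h)
    rcases u with a | a <;> rcases v with b | b <;> simp at hadj <;>
      simp [bipartiteGeodesic] <;> omega
  · exact (length_bipartiteGeodesic_le φ ψ u v).trans (two_le_length_of_not_adj huv hadj w)

theorem bipartiteGeodesic_eq_reverse (φ : Sym2 V → W) (ψ : Sym2 W → V) (u v : V ⊕ W) :
    bipartiteGeodesic φ ψ u v = (bipartiteGeodesic φ ψ v u).reverse := by
  apply Walk.ext_support
  rw [Walk.support_reverse]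
  rcases u with a | a <;> rcases v with b | b
  · by_cases h : a = b
    · subst h; simp [bipartiteGeodesic]
    · simp [bipartiteGeodesic, h, Ne.symm h, Sym2.eq_swap (a := a)]
  · simp [bipartiteGeodesic]
  · simp [bipartiteGeodesic]
  · by_cases h : a = b
    · subst h; simp [bipartiteGeodesic]
    · simp [bipartiteGeodesic, h, Ne.symm h, Sym2.eq_swap (a := a)]

theorem Finset.exists_forall_mem_exists_eq {α β : Type*} [Nonempty α] {s : Finset α}
    {t : Finset β} (h : s.card ≤ t.card) : ∃ f : β → α, ∀ x ∈ s, ∃ y ∈ t, f y = x := by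
  obtain ⟨e⟩ : Nonempty (s ↪ t) := Function.Embedding.nonempty_of_card_le (by simpa using h)
  have hinj : Function.Injective fun x : s => (e x : β) :=
    Subtype.val_injective.comp e.injective
  refine ⟨Function.extend (fun x : s => (e x : β)) Subtype.val fun _ => Classical.arbitrary α,
    fun x hx => ⟨e ⟨x, hx⟩, (e ⟨x, hx⟩).2, hinj.extend_apply _ _ ⟨x, hx⟩⟩⟩

variable [Fintype V] [Fintype W]

theorem isStrongGeodeticSet_completeBipartiteGraph [Nonempty V] [Nonempty W]
    (P : Finset V) (Q : Finset W)
    (hP : Fintype.card V ≤ P.card + Q.card.choose 2)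
    (hQ : Fintype.card W ≤ Q.card + P.card.choose 2) :
    IsStrongGeodeticSet (completeBipartiteGraph V W) (P.disjSum Q : Finset (V ⊕ W)) := by
  obtain ⟨φ, hφ⟩ := Finset.exists_forall_mem_exists_eq (s := Qᶜ)
    (t := P.offDiag.image Sym2.mk.uncurry)
    (by rw [Finset.card_compl]; have := Sym2.card_image_offDiag P; omega)
  obtain ⟨ψ, hψ⟩ := Finset.exists_forall_mem_exists_eq (s := Pᶜ)
    (t := Q.offDiag.image Sym2.mk.uncurry)
    (by rw [Finset.card_compl]; have := Sym2.card_image_offDiag Q; omega)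
  refine ⟨fun u _ v _ => bipartiteGeodesic φ ψ u v,
    fun u _ v _ => length_bipartiteGeodesic φ ψ u v,
    fun u _ v _ => bipartiteGeodesic_eq_reverse φ ψ u v, ?_⟩
  rintro (x | x)
  · by_cases hx : x ∈ P
    · exact ⟨.inl x, by simpa, .inl x, by simpa, Walk.start_mem_support _⟩
    · obtain ⟨y, hy, rfl⟩ := hψ x (by simpa using hx)
      obtain ⟨⟨a, b⟩, hab, rfl⟩ := Finset.mem_image.1 hy
      rw [Finset.mem_offDiag] at hab
      obtain ⟨ha, hb, hne⟩ := hab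
      exact ⟨.inr a, by simpa, .inr b, by simpa, by simp [bipartiteGeodesic, show a ≠ b from hne]⟩
  · by_cases hx : x ∈ Q
    · exact ⟨.inr x, by simpa, .inr x, by simpa, Walk.start_mem_support _⟩
    · obtain ⟨y, hy, rfl⟩ := hφ x (by simpa using hx)
      obtain ⟨⟨a, b⟩, hab, rfl⟩ := Finset.mem_image.1 hy
      rw [Finset.mem_offDiag] at hab
      obtain ⟨ha, hb, hne⟩ := hab
      exact ⟨.inl a, by simpa, .inl b, by simpa, by simp [bipartiteGeodesic, show a ≠ b from hne]⟩

theorem IsStrongGeodeticSet.card_le_of_completeBipartiteGraph [Nonempty V] [Nonempty W]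
    {S : Finset (V ⊕ W)} (hS : IsStrongGeodeticSet (completeBipartiteGraph V W) (S : Set (V ⊕ W))) :
    Fintype.card V ≤ S.toLeft.card + S.toRight.card.choose 2 ∧
      Fintype.card W ≤ S.toRight.card + S.toLeft.card.choose 2 := by
  have hdist : ∀ u v, (completeBipartiteGraph V W).dist u v ≤ 2 := fun u v => by
    rw [← length_bipartiteGeodesic (fun _ => Classical.arbitrary W) (fun _ => Classical.arbitrary V)]
    exact length_bipartiteGeodesic_le _ _ u v
  have h1 := hS.card_le_choose_two hdist (S.toLeftᶜ.map .inl) (S.toRight.map .inr)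
    (by simp) (by
      simp only [Finset.mem_map, Function.Embedding.inl_apply, forall_exists_index, and_imp]
      rintro _ a - rfl (u | u) hu hadj
      · simp at hadj
      · simpa using hu)
  have h2 := hS.card_le_choose_two hdist (S.toRightᶜ.map .inr) (S.toLeft.map .inl)
    (by simp) (by
      simp only [Finset.mem_map, Function.Embedding.inr_apply, forall_exists_index, and_imp]
      rintro _ a - rfl (u | u) hu hadj
      · simpa using hu
      · simp at hadj)
  simp only [Finset.card_map, Finset.card_compl] at h1 h2
  omega

end CompleteBipartite

theorem isLeast_strongGeodeticNumber_completeBipartiteGraph {n m : ℕ} (hn : 0 < n) (hm : 0 < m) :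
    IsLeast {k | ∃ p q, p + q = k ∧ p ≤ n ∧ q ≤ m ∧ n ≤ p + q.choose 2 ∧ m ≤ q + p.choose 2}
      (strongGeodeticNumber (completeBipartiteGraph (Fin n) (Fin m))) := by
  have : NeZero n := ⟨hn.ne'⟩
  have : NeZero m := ⟨hm.ne'⟩
  have hset : {k | ∃ S : Finset (Fin n ⊕ Fin m), S.card = k ∧
        IsStrongGeodeticSet (completeBipartiteGraph (Fin n) (Fin m)) ↑S} =
      {k | ∃ p q, p + q = k ∧ p ≤ n ∧ q ≤ m ∧ n ≤ p + q.choose 2 ∧ m ≤ q + p.choose 2} := by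
    ext k
    constructor
    · rintro ⟨S, rfl, hS⟩
      have := hS.card_le_of_completeBipartiteGraph
      simp only [Fintype.card_fin] at this
      exact ⟨_, _, S.card_toLeft_add_card_toRight, card_finset_fin_le _, card_finset_fin_le _, this⟩
    · rintro ⟨p, q, rfl, hp, hq, h1, h2⟩
      obtain ⟨P, -, rfl⟩ := Finset.exists_subset_card_eq (s := (Finset.univ : Finset (Fin n)))
        (by simpa using hp)
      obtain ⟨Q, -, rfl⟩ := Finset.exists_subset_card_eq (s := (Finset.univ : Finset (Fin m)))
        (by simpa using hq)
      exact ⟨P.disjSum Q, Finset.card_disjSum _ _,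
        isStrongGeodeticSet_completeBipartiteGraph P Q (by simpa using h1) (by simpa using h2)⟩
  rw [← hset]
  have hne : {k | ∃ S : Finset (Fin n ⊕ Fin m), S.card = k ∧
      IsStrongGeodeticSet (completeBipartiteGraph (Fin n) (Fin m)) ↑S}.Nonempty := by
    rw [hset]
    exact ⟨n + m, n, m, rfl, le_rfl, le_rfl, by omega, by omega⟩
  exact ⟨Nat.sInf_mem hne, fun k hk => Nat.sInf_le hk⟩

theorem le_choose_fFun (n p : ℕ) : n ≤ p + (fFun n p).choose 2 := by
  have h : n - p ≤ (fFun n p).choose 2 :=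
    Nat.sInf_mem (s := {q : ℕ | n - p ≤ q.choose 2}) ⟨n + 1, by
      show n - p ≤ (n + 1).choose 2
      rw [Nat.choose_succ_succ' n 1, Nat.choose_one_right]
      omega⟩
  omega

theorem fFun_le {n p q : ℕ} (h : n ≤ p + q.choose 2) : fFun n p ≤ q :=
  Nat.sInf_le (show n - p ≤ q.choose 2 by omega)

theorem add_choose_two_le_choose_add {d q : ℕ} (h : 1 ≤ q ∨ 3 ≤ d) :
    d + q.choose 2 ≤ (d + q).choose 2 := by
  have h1 : (1 : ℚ) ≤ q ∨ (3 : ℚ) ≤ d := by exact_mod_cast h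
  have hq : (0 : ℚ) ≤ q := q.cast_nonneg
  have hd : (0 : ℚ) ≤ d * (d - 1) := by
    rcases d.eq_zero_or_pos with rfl | h
    · simp
    · have : (1 : ℚ) ≤ d := by exact_mod_cast h
      nlinarith
  suffices ((d + q.choose 2 : ℕ) : ℚ) ≤ ((d + q).choose 2 : ℕ) by exact_mod_cast this
  push_cast [Nat.cast_choose_two]
  rcases h1 with h1 | h1 <;> nlinarith [d.cast_nonneg (α := ℚ)]

/-- Theorem 2.4, "otherwise" case: if `7 ≤ n ≤ m`, `m ≤ 3 + binom(n-3,2)` and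
`n - 3 < binom(m-3,2)`, and `x* ∈ [3, n-3]` solves `g̃(x*) = f̃(x*)`, then
`sg(K_{n,m}) = min {G(⌈x*⌉ - 1), F(⌈x*⌉)}`. -/
theorem sg_completeBipartite_case4 (n m : ℕ) (h7 : 7 ≤ n) (hnm : n ≤ m)
    (hm : m ≤ 3 + (n - 3).choose 2) (hcase : n - 3 < (m - 3).choose 2)
    (x : ℝ) (hx : x ∈ Set.Icc (3 : ℝ) ((n : ℝ) - 3))
    (hroot : gtilde m x = ftilde n x) :
    (strongGeodeticNumber (completeBipartiteGraph (Fin n) (Fin m)) : ℤ) =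
      min ((⌈x⌉ - 1) + gFun m (⌈x⌉ - 1).toNat)
          ((⌈x⌉ : ℤ) + (fFun n (⌈x⌉).toNat : ℤ)) := by
  obtain ⟨hx3, hxn⟩ := hx
  set r : ℝ := ftilde n x with hr
  have hsq := Real.sq_sqrt (show (0 : ℝ) ≤ 1 + 8 * ((n : ℝ) - x) by linarith)
  have hr_eq : r * (r - 1) / 2 = n - x := by
    simp only [hr, ftilde]
    nlinarith
  have hr3 : 3 ≤ r := by
    have : (5 : ℝ) ≤ √(1 + 8 * ((n : ℝ) - x)) := Real.le_sqrt_of_sq_le (by linarith)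
    simp only [hr, ftilde]
    linarith
  have hm_eq : (m : ℝ) = r + x * (x - 1) / 2 := by
    simp only [gtilde] at hroot
    linarith
  have hx3' : 3 < x := by
    refine lt_of_le_of_ne hx3 fun h => ?_
    have h' : ((n - 3 : ℕ) : ℝ) < ((m - 3).choose 2 : ℕ) := by exact_mod_cast hcase
    rw [Nat.cast_choose_two, Nat.cast_sub (by omega), Nat.cast_sub (by omega)] at h'
    push_cast at h'
    subst h
    have : (m : ℝ) - 3 = r := by linarith
    rw [this] at h'
    linarith
  obtain ⟨j, hj⟩ : ∃ j : ℕ, ⌈x⌉ = (j : ℤ) + 1 := by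
    have : 0 < ⌈x⌉ := Int.ceil_pos.2 (by linarith)
    exact ⟨(⌈x⌉ - 1).toNat, by omega⟩
  have hxj : (j : ℝ) < x := by
    have := Int.lt_ceil.1 (show (j : ℤ) < ⌈x⌉ by omega)
    exact_mod_cast this
  have hxk : x ≤ j + 1 := by
    have := Int.ceil_le.1 hj.le
    exact_mod_cast this
  have hj3 : 3 ≤ j := by
    have : (2 : ℝ) < j := by linarith
    exact_mod_cast this
  have hjn : j + 4 ≤ n := by
    have : ((j + 3 : ℕ) : ℝ) < n := by push_cast; linarith
    exact_mod_cast this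
  rw [hj, add_sub_cancel_right, Int.toNat_natCast, show ((j : ℤ) + 1).toNat = j + 1 by omega]
  have hj3' : (3 : ℝ) ≤ j := by exact_mod_cast hj3
  -- feasibility at `⌈x⌉ - 1`
  have hgj : (r : ℝ) + 5 / 2 * (x - j) ≤ m - (j.choose 2 : ℕ) := by
    rw [Nat.cast_choose_two, hm_eq]
    nlinarith
  have hjm : j.choose 2 ≤ m := by
    have : ((j.choose 2 : ℕ) : ℝ) ≤ m := by linarith
    exact_mod_cast this
  obtain ⟨q, hq⟩ := Nat.exists_eq_add_of_le hjm
  have hq' : (m : ℝ) = (j.choose 2 : ℕ) + q := by exact_mod_cast hq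
  have hnq : n ≤ j + q.choose 2 := by
    have : (n : ℝ) ≤ ((j + q.choose 2 : ℕ) : ℝ) := by
      push_cast
      rw [Nat.cast_choose_two]
      have : r + 5 / 2 * (x - j) ≤ q := by linarith
      nlinarith
    exact_mod_cast this
  -- feasibility at `⌈x⌉`
  have hmf : m ≤ fFun n (j + 1) + (j + 1).choose 2 := by
    have h1 : (n : ℝ) ≤ ((j + 1 + (fFun n (j + 1)).choose 2 : ℕ) : ℝ) := by
      exact_mod_cast le_choose_fFun n (j + 1)
    have hf3 : 3 ≤ fFun n (j + 1) := by
      by_contra! h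
      have h2 := Nat.choose_le_choose 2 (show fFun n (j + 1) ≤ 2 by omega)
      have h3 := le_choose_fFun n (j + 1)
      simp at h2
      omega
    have hf3' : (3 : ℝ) ≤ fFun n (j + 1) := by exact_mod_cast hf3
    have : (m : ℝ) ≤ ((fFun n (j + 1) + (j + 1).choose 2 : ℕ) : ℝ) := by
      push_cast [Nat.cast_choose_two] at h1 ⊢
      generalize (fFun n (j + 1) : ℝ) = f at *
      by_contra! h
      have h2 : 5 / 2 * (j + 1 - x) < r - f := by nlinarith
      nlinarith
    exact_mod_cast this
  obtain ⟨⟨p₀, q₀, hsg, hp₀, hq₀, hn₀, hm₀⟩, hle⟩ :=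
    isLeast_strongGeodeticNumber_completeBipartiteGraph (n := n) (m := m) (by omega) (by omega)
  have hG : (j : ℤ) + gFun m j = ((j + q : ℕ) : ℤ) := by
    simp only [gFun]
    push_cast [hq]
    ring
  rw [hG]
  norm_cast
  refine le_antisymm (le_min ?_ ?_) ?_
  · exact hle ⟨j, q, rfl, by omega, by omega, hnq, by omega⟩
  · refine hle ⟨j + 1, fFun n (j + 1), rfl, by omega, fFun_le ?_, le_choose_fFun _ _, hmf⟩
    obtain ⟨k, rfl⟩ := Nat.exists_eq_add_of_le' (show 1 ≤ m by omega)
    rw [Nat.choose_succ_succ' k 1, Nat.choose_one_right]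
    omega
  rw [← hsg]
  rcases Nat.lt_or_ge j p₀ with hp | hp
  · refine (min_le_right _ _).trans ?_
    obtain ⟨d, rfl⟩ := Nat.exists_eq_add_of_le (Nat.succ_le_of_lt hp)
    have : fFun n (j + 1) ≤ d + q₀ := by
      apply fFun_le
      have := add_choose_two_le_choose_add (d := d) (q := q₀) (by
        rcases Nat.eq_zero_or_pos q₀ with rfl | h
        · simp at hn₀
          omega
        · exact .inl h)
      omega
    omega
  · refine (min_le_left _ _).trans ?_
    have hmono : j + p₀.choose 2 ≤ p₀ + j.choose 2 := by
      obtain ⟨d, rfl⟩ := Nat.exists_eq_add_of_le' hp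
      have := add_choose_two_le_choose_add (d := d) (q := p₀) (by omega)
      omega
    omega
end

section
/- For every integer n ≥ 2, the strong geodetic number of the hypercube Q_n satisfies sg(Q_n) ≤ (3/2)·2^(n/2) - (⌈(n+1)/2⌉ - 2)(⌈(n+1)/2⌉ - 3) if n is even, and sg(Q_n) ≤ 2^((n+1)/2) - (n-3)(n-5)/4 if n is odd (all quantities interpreted as integers; for odd n the term (n-3)(n-5)/4 is an integer). -/
open SimpleGraph

/-- The hypercube graph `Qₙ` on vertex set `{0,1}ⁿ`; two vertices are adjacent iff
they differ in exactly one coordinate. -/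
def hypercube (n : ℕ) : SimpleGraph (Fin n → Bool) :=
  SimpleGraph.fromRel fun x y => ∃ i, x i ≠ y i ∧ ∀ j, j ≠ i → x j = y j

/-- Geodesics meeting prescribed sets `K u v` can be fixed consistently for unordered pairs. -/
theorem exists_symm_geodesics {V : Type*} (G : SimpleGraph V) (K : V → V → Set V)
    (hK : ∀ u v, K u v = K v u)
    (h : ∀ u v, ∃ p : G.Walk u v, p.length = G.dist u v ∧ ∀ z ∈ K u v, z ∈ p.support) :
    ∃ γ : ∀ u v, G.Walk u v, (∀ u v, (γ u v).length = G.dist u v) ∧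
      (∀ u v, γ u v = (γ v u).reverse) ∧ ∀ u v, ∀ z ∈ K u v, z ∈ (γ u v).support := by
  classical
  choose p hp hpK using h
  refine ⟨fun u v => if WellOrderingRel u v then p u v else (p v u).reverse, ?_, ?_, ?_⟩
  · intro u v
    dsimp only
    split_ifs
    · exact hp u v
    · rw [Walk.length_reverse, hp, dist_comm]
  · intro u v
    dsimp only
    rcases trichotomous_of WellOrderingRel u v with h | rfl | h
    · rw [if_pos h, if_neg (asymm h), Walk.reverse_reverse]
    · have h0 : p u u = Walk.nil :=
        Walk.eq_nil_iff_nil.mpr (Walk.length_eq_zero_iff.mp (by rw [hp, dist_self]))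
      simp [h0]
    · rw [if_neg (asymm h), if_pos h]
  · intro u v z hz
    dsimp only
    split_ifs
    · exact hpK u v z hz
    · rw [Walk.support_reverse, List.mem_reverse]
      exact hpK v u z (hK u v ▸ hz)

/-- The symmetric chain decomposition of the subsets of `s`, encoded by the map `f` sending a set
to the largest member of its chain. -/
theorem exists_symmetric_chain_decomposition {α : Type*} [DecidableEq α] (s : Finset α) :
    ∃ f : Finset α → Finset α, ∀ x ⊆ s,
      x ⊆ f x ∧ f x ⊆ s ∧ f (f x) = f x ∧ s.card ≤ x.card + (f x).card ∧
      (∀ y ⊆ s, f x = f y → x ⊆ y ∨ y ⊆ x) ∧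
      ∀ r, s.card ≤ r + (f x).card → r ≤ (f x).card → ∃ y ⊆ s, f y = f x ∧ y.card = r := by
  induction s using Finset.induction_on with
  | empty =>
    refine ⟨id, fun x hx => ?_⟩
    obtain rfl := Finset.subset_empty.mp hx
    simp
  | insert a s ha ih =>
    obtain ⟨f, hf⟩ := ih
    have hpred : ∀ t, ∃ y, (∃ x ⊆ s, f x ≠ x ∧ f x = t) →
        y ⊆ s ∧ f y = t ∧ y.card + 1 = t.card := by
      intro t
      by_cases ht : ∃ x ⊆ s, f x ≠ x ∧ f x = t
      · obtain ⟨x, hx, hne, rfl⟩ := ht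
        obtain ⟨h1, -, -, h4, -, h6⟩ := hf x hx
        have hlt : x.card < (f x).card := Finset.card_lt_card (h1.ssubset_of_ne hne.symm)
        obtain ⟨y, hy, hyf, hyc⟩ := h6 ((f x).card - 1) (by omega) (by omega)
        exact ⟨y, fun _ => ⟨hy, hyf, by omega⟩⟩
      · exact ⟨∅, fun h => absurd h ht⟩
    choose q hq using hpred
    replace hq : ∀ x ⊆ s, f x ≠ x → q (f x) ⊆ s ∧ f (q (f x)) = f x ∧
        (q (f x)).card + 1 = (f x).card ∧ x ⊆ q (f x) := by
      intro x hx hne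
      obtain ⟨hqs, hqf, hqc⟩ := hq (f x) ⟨x, hx, hne, rfl⟩
      obtain ⟨h1, -, -, -, h5, -⟩ := hf x hx
      have hlt : x.card < (f x).card := Finset.card_lt_card (h1.ssubset_of_ne hne.symm)
      refine ⟨hqs, hqf, hqc, (h5 _ hqs hqf.symm).elim id fun h => ?_⟩
      exact (Finset.eq_of_subset_of_card_le h (by omega)).ge
    have has : ∀ x ⊆ s, a ∉ x := fun x hx h => ha (hx h)
    let F : Finset α → Finset α := fun z =>
      if a ∈ z then
        if f (z.erase a) = z.erase a then z else insert a (q (f (z.erase a)))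
      else insert a (f z)
    have F0 : ∀ x ⊆ s, F x = insert a (f x) := fun x hx => by simp [F, has x hx]
    have F1 : ∀ x ⊆ s, f x = x → F (insert a x) = insert a x := fun x hx h => by
      simp [F, Finset.erase_insert (has x hx), h]
    have F2 : ∀ x ⊆ s, f x ≠ x → F (insert a x) = insert a (q (f x)) := fun x hx h => by
      simp [F, Finset.erase_insert (has x hx), h]
    have hins : ∀ x ⊆ s, ∀ y ⊆ s, insert a x = insert a y → x = y := fun x hx y hy h => by
      rw [← Finset.erase_insert (has x hx), h, Finset.erase_insert (has y hy)]
    have hcases : ∀ z ⊆ insert a s, z ⊆ s ∨ ∃ x ⊆ s, z = insert a x := by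
      intro z hz
      by_cases hza : a ∈ z
      · exact Or.inr ⟨z.erase a, Finset.subset_insert_iff.mp hz, (Finset.insert_erase hza).symm⟩
      · exact Or.inl ((Finset.subset_insert_iff_of_notMem hza).mp hz)
    have hcard : ∀ x ⊆ s, (insert a x).card = x.card + 1 := fun x hx =>
      Finset.card_insert_of_notMem (has x hx)
    have hqne : ∀ x ⊆ s, f x ≠ x → f (q (f x)) ≠ q (f x) := by
      intro x hx hne h
      obtain ⟨-, h2, h3, -⟩ := hq x hx hne
      rw [h2] at h
      rw [← h] at h3
      omega
    have hqtop : ∀ x ⊆ s, f x ≠ x → ∀ y ⊆ s, f y ≠ q (f x) := by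
      intro x hx hne y hy h
      exact hqne x hx hne (h ▸ (hf y hy).2.2.1)
    refine ⟨F, fun z hz => ?_⟩
    rw [hcard s subset_rfl]
    rcases hcases z hz with hx | ⟨x, hx, rfl⟩
    · obtain ⟨h1, h2, h3, h4, h5, h6⟩ := hf z hx
      rw [F0 z hx, F1 _ h2 h3, hcard _ h2]
      refine ⟨h1.trans (Finset.subset_insert _ _), Finset.insert_subset_insert _ h2, rfl,
        by omega, ?_, ?_⟩
      · intro y hys h
        rcases hcases y hys with hy | ⟨y, hy, rfl⟩
        · rw [F0 y hy] at h
          exact h5 y hy (hins _ h2 _ (hf y hy).2.1 h)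
        · by_cases hyt : f y = y
          · rw [F1 y hy hyt] at h
            rw [← hins _ h2 _ hy h]
            exact Or.inl (h1.trans (Finset.subset_insert _ _))
          · rw [F2 y hy hyt] at h
            exact absurd (hins _ h2 _ (hq y hy hyt).1 h) (hqtop y hy hyt z hx)
      · intro r hr hr'
        rcases hr'.lt_or_eq with hlt | rfl
        · obtain ⟨y, hy, hyf, hyc⟩ := h6 r (by omega) (by omega)
          exact ⟨y, hy.trans (Finset.subset_insert _ _), by rw [F0 y hy, hyf], hyc⟩
        · exact ⟨insert a (f z), Finset.insert_subset_insert _ h2, F1 _ h2 h3, hcard _ h2⟩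
    · obtain ⟨h1, h2, h3, h4, h5, h6⟩ := hf x hx
      by_cases hxt : f x = x
      · rw [F1 x hx hxt, F1 x hx hxt, hcard x hx]
        rw [hxt] at h4 h6
        refine ⟨subset_rfl, Finset.insert_subset_insert _ hx, rfl, by omega, ?_, ?_⟩
        · intro y hys h
          rcases hcases y hys with hy | ⟨y, hy, rfl⟩
          · rw [F0 y hy] at h
            rw [hins _ hx _ (hf y hy).2.1 h]
            exact Or.inr ((hf y hy).1.trans (Finset.subset_insert _ _))
          · by_cases hyt : f y = y
            · rw [F1 y hy hyt] at h
              exact Or.inl h.le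
            · rw [F2 y hy hyt] at h
              exact absurd (hxt.trans (hins _ hx _ (hq y hy hyt).1 h)) (hqtop y hy hyt x hx)
        · intro r hr hr'
          rcases hr'.lt_or_eq with hlt | rfl
          · obtain ⟨y, hy, hyf, hyc⟩ := h6 r (by omega) (by omega)
            exact ⟨y, hy.trans (Finset.subset_insert _ _), by rw [F0 y hy, hyf], hyc⟩
          · exact ⟨insert a x, Finset.insert_subset_insert _ hx, F1 _ hx hxt, hcard _ hx⟩
      · obtain ⟨q1, q2, q3, q4⟩ := hq x hx hxt
        rw [F2 x hx hxt, F2 _ q1 (hqne x hx hxt), q2, hcard x hx, hcard _ q1]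
        refine ⟨Finset.insert_subset_insert _ q4, Finset.insert_subset_insert _ q1, rfl,
          by omega, ?_, ?_⟩
        · intro y hys h
          rcases hcases y hys with hy | ⟨y, hy, rfl⟩
          · rw [F0 y hy] at h
            exact absurd (hins _ q1 _ (hf y hy).2.1 h).symm (hqtop x hx hxt y hy)
          · by_cases hyt : f y = y
            · rw [F1 y hy hyt] at h
              exact absurd (hyt.trans (hins _ q1 _ hy h).symm) (hqtop x hx hxt y hy)
            · rw [F2 y hy hyt] at h
              have := congrArg f (hins _ q1 _ (hq y hy hyt).1 h)
              rw [q2, (hq y hy hyt).2.1] at this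
              exact (h5 y hy this).imp (Finset.insert_subset_insert _)
                (Finset.insert_subset_insert _)
        · intro r hr hr'
          have := Finset.card_le_card h2
          obtain ⟨y, hy, hyf, hyc⟩ := h6 (r - 1) (by omega) (by omega)
          have hyt : f y ≠ y := by
            intro h
            rw [hyf] at h
            rw [← h] at hyc
            omega
          exact ⟨insert a y, Finset.insert_subset_insert _ hy, by rw [F2 y hy hyt, hyf],
            by rw [hcard y hy]; omega⟩

/-- The vertex of the hypercube with support `x`. -/
def hypercubeVertex {n : ℕ} (x : Finset (Fin n)) : Fin n → Bool := fun i => decide (i ∈ x)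

theorem hypercubeVertex_filter {n : ℕ} (v : Fin n → Bool) :
    hypercubeVertex (Finset.univ.filter fun i => v i = true) = v := by
  ext i
  simp [hypercubeVertex]

theorem hypercube_adj_insert {n : ℕ} {x : Finset (Fin n)} {i : Fin n} (hi : i ∉ x) :
    (hypercube n).Adj (hypercubeVertex x) (hypercubeVertex (insert i x)) := by
  have hne : hypercubeVertex x i ≠ hypercubeVertex (insert i x) i := by
    simp [hypercubeVertex, hi]
  rw [hypercube, SimpleGraph.fromRel_adj]
  refine ⟨fun h => hne (congrFun h i), Or.inl ⟨i, hne, fun j hj => ?_⟩⟩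
  simp [hypercubeVertex, hj]

theorem hypercube_adj_card_le {n : ℕ} {x y : Finset (Fin n)}
    (h : (hypercube n).Adj (hypercubeVertex x) (hypercubeVertex y)) : y.card ≤ x.card + 1 := by
  have key : ∃ i, ∀ j, j ≠ i → (j ∈ y → j ∈ x) := by
    rw [hypercube, SimpleGraph.fromRel_adj] at h
    rcases h.2 with ⟨i, -, hi⟩ | ⟨i, -, hi⟩ <;> refine ⟨i, fun j hj hjy => ?_⟩ <;>
      have := hi j hj <;> simp_all [hypercubeVertex]
  obtain ⟨i, hi⟩ := key
  refine (Finset.card_le_card (t := insert i x) fun j hj => ?_).trans (Finset.card_insert_le _ _)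
  by_cases hji : j = i
  · simp [hji]
  · exact Finset.mem_insert_of_mem (hi j hji hj)

theorem hypercube_card_le_walk {n : ℕ} {u v : Fin n → Bool} (p : (hypercube n).Walk u v) :
    (Finset.univ.filter fun i => v i = true).card ≤
      (Finset.univ.filter fun i => u i = true).card + p.length := by
  induction p with
  | nil => simp
  | @cons u w v h p ih =>
    rw [← hypercubeVertex_filter u, ← hypercubeVertex_filter w] at h
    have := hypercube_adj_card_le h
    rw [Walk.length_cons]
    omega

/-- A chain of sets between `u` and `v` lies on a monotone walk. -/
theorem exists_walk_through_chain {n : ℕ} (v : Finset (Fin n)) (C : Set (Finset (Fin n)))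
    (hC : IsChain (· ⊆ ·) C) (hv : ∀ c ∈ C, c ⊆ v) (k : ℕ) :
    ∀ u ⊆ v, u.card + k = v.card →
      ∃ p : (hypercube n).Walk (hypercubeVertex u) (hypercubeVertex v), p.length = k ∧
        ∀ c ∈ C, u ⊆ c → hypercubeVertex c ∈ p.support := by
  induction k with
  | zero =>
    intro u huv hcard
    obtain rfl := Finset.eq_of_subset_of_card_le huv (by omega)
    refine ⟨Walk.nil, rfl, fun c hc huc => ?_⟩
    rw [(hv c hc).antisymm huc]
    simp
  | succ k ih =>
    intro u huv hcard
    obtain ⟨w, huw, hwv, hw⟩ : ∃ w, u ⊂ w ∧ w ⊆ v ∧ ∀ c ∈ C, u ⊂ c → w ⊆ c := by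
      by_cases h : ∃ c ∈ C, u ⊂ c
      · obtain ⟨w, hw, hmin⟩ := Set.Finite.exists_minimal
          (Set.toFinite {c | c ∈ C ∧ u ⊂ c}) h
        refine ⟨w, hw.2, hv w hw.1, fun c hc huc => ?_⟩
        exact (hC.total hw.1 hc).elim id fun hcw => hmin ⟨hc, huc⟩ hcw
      · refine ⟨v, huv.ssubset_of_ne ?_, subset_rfl, fun c hc huc => absurd ⟨c, hc, huc⟩ h⟩
        rintro rfl
        omega
    obtain ⟨i, hiw, hiu⟩ := Finset.exists_of_ssubset huw
    have hiuw : insert i u ⊆ w := Finset.insert_subset hiw huw.subset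
    obtain ⟨p, hp, hpC⟩ := ih (insert i u) (hiuw.trans hwv)
      (by rw [Finset.card_insert_of_notMem hiu]; omega)
    refine ⟨Walk.cons (hypercube_adj_insert hiu) p, by simp [hp], fun c hc huc => ?_⟩
    rw [Walk.support_cons]
    rcases eq_or_ne u c with rfl | hne
    · exact List.mem_cons_self
    · exact List.mem_cons_of_mem _ (hpC c hc (hiuw.trans (hw c hc (huc.ssubset_of_ne hne))))

theorem exists_geodesic_through_chain {n : ℕ} {u v : Finset (Fin n)} (huv : u ⊆ v)
    {C : Set (Finset (Fin n))} (hC : IsChain (· ⊆ ·) C) (hCuv : ∀ c ∈ C, u ⊆ c ∧ c ⊆ v) :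
    ∃ p : (hypercube n).Walk (hypercubeVertex u) (hypercubeVertex v),
      p.length = (hypercube n).dist (hypercubeVertex u) (hypercubeVertex v) ∧
        ∀ c ∈ C, hypercubeVertex c ∈ p.support := by
  obtain ⟨p, hp, hpC⟩ := exists_walk_through_chain v C hC (fun c hc => (hCuv c hc).2)
    (v.card - u.card) u huv (by have := Finset.card_le_card huv; omega)
  refine ⟨p, le_antisymm ?_ (SimpleGraph.dist_le p), fun c hc => hpC c hc (hCuv c hc).1⟩
  obtain ⟨g, hg⟩ := p.reachable.exists_walk_length_eq_dist
  have := hypercube_card_le_walk g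
  simp only [hypercubeVertex, decide_eq_true_eq, Finset.filter_univ_mem] at this
  rw [hp, ← hg]
  omega

theorem hypercube_preconnected (n : ℕ) : (hypercube n).Preconnected := by
  have h : ∀ v, (hypercube n).Reachable v (hypercubeVertex Finset.univ) := by
    intro v
    rw [← hypercubeVertex_filter v]
    obtain ⟨p, -⟩ := exists_geodesic_through_chain (C := ∅) (Finset.subset_univ _)
      (by simp) (by simp)
    exact p.reachable
  exact fun u v => (h u).trans (h v).symm

theorem strongGeodeticNumber_hypercube_le {n b : ℕ} (hb : 1 ≤ b) (hbn : b ≤ n) :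
    strongGeodeticNumber (hypercube n) ≤ 2 ^ (n - b) + b.choose (b / 2) := by
  classical
  obtain ⟨s, -, hs⟩ := Finset.exists_subset_card_eq (s := (Finset.univ : Finset (Fin n)))
    (n := b) (by simpa using hbn)
  obtain ⟨f, hf⟩ := exists_symmetric_chain_decomposition s
  let T := s.powerset.image f
  have hT : T.card ≤ b.choose (b / 2) := by
    have hmid : ∀ t, ∃ y, t ∈ T → y ⊆ s ∧ f y = t ∧ y.card = b / 2 := by
      intro t
      by_cases ht : t ∈ T
      · obtain ⟨x, hx, rfl⟩ := Finset.mem_image.mp ht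
        obtain ⟨h1, -, -, h4, -, h6⟩ := hf x (Finset.mem_powerset.mp hx)
        have := Finset.card_le_card h1
        obtain ⟨y, hy⟩ := h6 (b / 2) (by omega) (by omega)
        exact ⟨y, fun _ => hy⟩
      · exact ⟨∅, fun h => absurd h ht⟩
    choose y hy using hmid
    rw [← hs, ← Finset.card_powersetCard, hs]
    refine Finset.card_le_card_of_injOn y (fun t ht => ?_) fun t ht t' ht' h => ?_
    · exact Finset.mem_coe.mpr (Finset.mem_powersetCard.mpr ⟨(hy t ht).1, (hy t ht).2.2⟩)
    · rw [← (hy t ht).2.1, h, (hy t' ht').2.1]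
  let A := sᶜ.powerset
  let B := T.image (sᶜ ∪ ·)
  have hAB : ∀ x ∈ A, x ∉ B := by
    intro x hx hxB
    obtain ⟨t, ht, rfl⟩ := Finset.mem_image.mp hxB
    obtain ⟨y, hy, rfl⟩ := Finset.mem_image.mp ht
    obtain ⟨h1, h2, -, h4, -⟩ := hf y (Finset.mem_powerset.mp hy)
    have h0 : f y = ∅ := by
      refine Finset.eq_empty_of_forall_notMem fun i hi => ?_
      have := Finset.mem_powerset.mp hx (Finset.mem_union_right _ hi)
      exact Finset.mem_compl.mp this (h2 hi)
    have := Finset.card_le_card h1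
    rw [h0, Finset.card_empty] at this h4
    omega
  let K : Finset (Fin n) → Finset (Fin n) → Set (Finset (Fin n)) := fun u v =>
    {z | u ∈ A ∧ v ∈ B ∧ z \ s = u ∧ sᶜ ∪ f (z ∩ s) = v}
  let φ : (Fin n → Bool) → Finset (Fin n) := fun v => Finset.univ.filter fun i => v i = true
  have hφ : ∀ v, hypercubeVertex (φ v) = v := hypercubeVertex_filter
  have hφ' : ∀ x, φ (hypercubeVertex x) = x := fun x => by simp [φ, hypercubeVertex]
  have hunion : ∀ t ⊆ s, ∀ t' ⊆ s, sᶜ ∪ t = sᶜ ∪ t' → t = t' := by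
    intro t ht t' ht' h
    ext i
    have := Finset.ext_iff.mp h i
    simp only [Finset.mem_union, Finset.mem_compl] at this
    have := @ht i
    have := @ht' i
    tauto
  have hKp : ∀ u v, ∃ p : (hypercube n).Walk (hypercubeVertex u) (hypercubeVertex v),
      p.length = (hypercube n).dist (hypercubeVertex u) (hypercubeVertex v) ∧
        ∀ z ∈ K u v, hypercubeVertex z ∈ p.support := by
    intro u v
    by_cases huv : u ∈ A ∧ v ∈ B
    · obtain ⟨hu, hv⟩ := huv
      refine exists_geodesic_through_chain ?_ ?_ ?_
      · obtain ⟨t, -, rfl⟩ := Finset.mem_image.mp hv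
        exact (Finset.mem_powerset.mp hu).trans Finset.subset_union_left
      · rintro z ⟨-, -, hz, hz'⟩ w ⟨-, -, hw, hw'⟩ -
        have hfz := hf (z ∩ s) Finset.inter_subset_right
        have hfw := hf (w ∩ s) Finset.inter_subset_right
        have := hfz.2.2.2.2.1 _ Finset.inter_subset_right
          (hunion _ hfz.2.1 _ hfw.2.1 (hz'.trans hw'.symm))
        dsimp only
        rw [← Finset.sdiff_union_inter z s, ← Finset.sdiff_union_inter w s, hz, hw]
        exact this.imp (Finset.union_subset_union_right ·) (Finset.union_subset_union_right ·)
      · rintro z ⟨-, -, rfl, rfl⟩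
        refine ⟨Finset.sdiff_subset, ?_⟩
        nth_rw 1 [← Finset.sdiff_union_inter z s]
        refine Finset.union_subset_union (fun i hi => ?_)
          (hf _ Finset.inter_subset_right).1
        exact Finset.mem_compl.mpr (Finset.mem_sdiff.mp hi).2
    · obtain ⟨p, hp⟩ := (hypercube_preconnected n
        (hypercubeVertex u) (hypercubeVertex v)).exists_walk_length_eq_dist
      exact ⟨p, hp, fun z hz => absurd ⟨hz.1, hz.2.1⟩ huv⟩
  have hKne : ∀ u v z, z ∈ K u v → K v u = ∅ := fun u v z hz =>
    Set.eq_empty_of_forall_notMem fun z' hz' => hAB u hz.1 hz'.2.1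
  obtain ⟨γ, hγ, hγs, hγK⟩ := exists_symm_geodesics (hypercube n)
    (fun u v => {z | φ z ∈ K (φ u) (φ v) ∨ φ z ∈ K (φ v) (φ u)})
    (fun u v => Set.ext fun z => or_comm) (by
      intro u v
      obtain ⟨u, rfl⟩ : ∃ x, hypercubeVertex x = u := ⟨_, hφ u⟩
      obtain ⟨v, rfl⟩ : ∃ x, hypercubeVertex x = v := ⟨_, hφ v⟩
      simp only [hφ', Set.mem_ofPred_eq]
      by_cases huv : ∃ z, z ∈ K u v
      · obtain ⟨z, hz⟩ := huv
        obtain ⟨p, hp, hpK⟩ := hKp u v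
        refine ⟨p, hp, fun x hx => ?_⟩
        rw [hKne u v z hz, Set.mem_empty_iff_false, or_false] at hx
        simpa only [hφ] using hpK _ hx
      · obtain ⟨p, hp, hpK⟩ := hKp v u
        refine ⟨p.reverse, by rw [Walk.length_reverse, hp, dist_comm], fun x hx => ?_⟩
        rw [Walk.support_reverse, List.mem_reverse]
        simpa only [hφ] using hpK _ (hx.resolve_left fun h => huv ⟨_, h⟩))
  have hcard : (A ∪ B).card ≤ 2 ^ (n - b) + b.choose (b / 2) := by
    refine (Finset.card_union_le _ _).trans (add_le_add ?_ (Finset.card_image_le.trans hT))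
    rw [Finset.card_powerset, Finset.card_compl, Fintype.card_fin, hs]
  have hS : IsStrongGeodeticSet (hypercube n) ↑((A ∪ B).image hypercubeVertex) := by
    refine ⟨fun u _ v _ => γ u v, fun u _ v _ => hγ u v, fun u _ v _ => hγs u v, fun x => ?_⟩
    have hu : φ x \ s ∈ A := Finset.mem_powerset.mpr fun i hi =>
      Finset.mem_compl.mpr (Finset.mem_sdiff.mp hi).2
    have hv : sᶜ ∪ f (φ x ∩ s) ∈ B := Finset.mem_image_of_mem _
      (Finset.mem_image_of_mem _ (Finset.mem_powerset.mpr Finset.inter_subset_right))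
    refine ⟨hypercubeVertex (φ x \ s), ?_, hypercubeVertex (sᶜ ∪ f (φ x ∩ s)), ?_,
      hγK _ _ x (Or.inl ?_)⟩
    · exact Finset.mem_coe.mpr (Finset.mem_image_of_mem _ (Finset.mem_union_left _ hu))
    · exact Finset.mem_coe.mpr (Finset.mem_image_of_mem _ (Finset.mem_union_right _ hv))
    · rw [hφ', hφ']
      exact ⟨hu, hv, rfl, rfl⟩
  have hle : strongGeodeticNumber (hypercube n) ≤ ((A ∪ B).image hypercubeVertex).card :=
    Nat.sInf_le ⟨_, rfl, hS⟩
  exact hle.trans (Finset.card_image_le.trans hcard)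

theorem choose_half_add_le_two_pow (k : ℕ) (hk : 5 ≤ k) :
    k.choose (k / 2) + (k - 2) * (k - 3) ≤ 2 ^ (k - 1) := by
  induction k, hk using Nat.le_induction with
  | base => decide
  | succ k hk ih =>
    have hc : (k + 1).choose ((k + 1) / 2) ≤ 2 * k.choose (k / 2) := by
      obtain ⟨j, hj⟩ : ∃ j, (k + 1) / 2 = j + 1 := ⟨(k + 1) / 2 - 1, by omega⟩
      rw [hj, Nat.choose_succ_succ, two_mul]
      exact add_le_add (Nat.choose_le_middle _ _) (Nat.choose_le_middle _ _)
    obtain ⟨l, rfl⟩ := Nat.exists_eq_add_of_le' hk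
    simp only [Nat.add_sub_cancel, show l + 5 - 1 = l + 4 by omega,
      show l + 5 - 2 = l + 3 by omega, show l + 5 - 3 = l + 2 by omega,
      show l + 5 + 1 - 2 = l + 4 by omega, show l + 5 + 1 - 3 = l + 3 by omega] at *
    rw [pow_succ 2 (l + 4)]
    nlinarith

theorem choose_half_succ_le {m : ℕ} (hm : 1 ≤ m) :
    ((m + 1).choose ((m + 1) / 2) : ℝ) ≤ 2 ^ m - ((m : ℝ) - 1) * ((m : ℝ) - 2) := by
  rcases lt_or_ge m 4 with h | h
  · interval_cases m <;> norm_num [Nat.choose]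
  · have := choose_half_add_le_two_pow (m + 1) (by omega)
    obtain ⟨l, rfl⟩ := Nat.exists_eq_add_of_le' h
    simp only [show l + 4 + 1 - 2 = l + 3 by omega, show l + 4 + 1 - 3 = l + 2 by omega,
      Nat.add_sub_cancel] at this
    have : (((l + 4 + 1).choose ((l + 4 + 1) / 2) + (l + 3) * (l + 2) : ℕ) : ℝ) ≤
      (2 ^ (l + 4) : ℕ) := by exact_mod_cast this
    push_cast at this ⊢
    linarith

/-- Theorem 4.3: for `n ≥ 2`,
`sg(Qₙ) ≤ (3/2)·2^(n/2) - (⌈(n+1)/2⌉ - 2)(⌈(n+1)/2⌉ - 3)` if `n` is even, and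
`sg(Qₙ) ≤ 2^((n+1)/2) - (n-3)(n-5)/4` if `n` is odd. -/
theorem sg_hypercube_upper2 (n : ℕ) (hn : 2 ≤ n) :
    (Even n → (strongGeodeticNumber (hypercube n) : ℝ) ≤
      3 / 2 * (2 : ℝ) ^ ((n : ℝ) / 2) -
        ((⌈((n : ℝ) + 1) / 2⌉ : ℝ) - 2) * ((⌈((n : ℝ) + 1) / 2⌉ : ℝ) - 3)) ∧
    (Odd n → (strongGeodeticNumber (hypercube n) : ℝ) ≤
      (2 : ℝ) ^ (((n : ℝ) + 1) / 2) - ((n : ℝ) - 3) * ((n : ℝ) - 5) / 4) := by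
  constructor
  · rintro ⟨m, rfl⟩
    have hm : 1 ≤ m := by omega
    have h := strongGeodeticNumber_hypercube_le (n := m + m) (b := m + 1) (by omega) (by omega)
    have h' : (strongGeodeticNumber (hypercube (m + m)) : ℝ) ≤
        2 ^ (m - 1) + ((m + 1).choose ((m + 1) / 2) : ℝ) := by
      rw [show m + m - (m + 1) = m - 1 by omega] at h
      exact_mod_cast h
    have hceil : ⌈(((m + m : ℕ) : ℝ) + 1) / 2⌉ = (m : ℤ) + 1 := by
      rw [Int.ceil_eq_iff]
      push_cast
      constructor <;> linarith
    have hpow : (2 : ℝ) ^ (((m + m : ℕ) : ℝ) / 2) = 2 ^ m := by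
      rw [← Real.rpow_natCast]
      congr 1
      push_cast
      ring
    have hpow' : (2 : ℝ) ^ m = 2 * 2 ^ (m - 1) := by
      rw [← pow_succ', Nat.sub_add_cancel hm]
    have hc := choose_half_succ_le hm
    rw [hceil, hpow]
    push_cast
    linarith
  · rintro ⟨m, rfl⟩
    have hm : 1 ≤ m := by omega
    have h := strongGeodeticNumber_hypercube_le (n := 2 * m + 1) (b := m + 1) (by omega) (by omega)
    have h' : (strongGeodeticNumber (hypercube (2 * m + 1)) : ℝ) ≤
        2 ^ m + ((m + 1).choose ((m + 1) / 2) : ℝ) := by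
      rw [show 2 * m + 1 - (m + 1) = m by omega] at h
      exact_mod_cast h
    have hpow : (2 : ℝ) ^ ((((2 * m + 1 : ℕ) : ℝ) + 1) / 2) = 2 * 2 ^ m := by
      rw [← pow_succ', ← Real.rpow_natCast]
      congr 1
      push_cast
      ring
    have hc := choose_half_succ_le hm
    rw [hpow]
    push_cast
    linarith
end
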